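/- Fix an orthonormal basis (e_1,…,e_d) of H and set p_n = |e_n⟩⟨e_n|. For a unitary operator U on H let 𝒢(U) = { ∑_{n=1}^d e^{iθ_n} U|e_{σ(n)}⟩⟨e_n| : σ a permutation of {1,…,d}, θ_1,…,θ_d ∈ ℝ }. Then for all unitary operators U, V on H, D_W({U p_n U* : 1 ≤ n ≤ d}, {V p_n V* : 1 ≤ n ≤ d}) = inf{‖K − G‖ : K ∈ 𝒢(U), G ∈ 𝒢(V)}. -/

import Mathlib

/- STATEMENT 3: With 𝒢(U) = {∑_n e^{iθ_n} U|e_{σ(n)}⟩⟨e_n|}, for all unitaries U, V: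
D_W({U p_n U*}, {V p_n V*}) = inf {‖K − G‖ : K ∈ 𝒢(U), G ∈ 𝒢(V)}. -/

noncomputable section

abbrev E (d : ℕ) : Type := EuclideanSpace ℂ (Fin d)
abbrev Op (d : ℕ) : Type := E d →L[ℂ] E d

/-- The rank-one operator `|x⟩⟨y| : h ↦ ⟨y, h⟩ x`. -/
def rankOne {d : ℕ} (x y : E d) : Op d :=
  (ContinuousLinearMap.toSpanSingleton ℂ x).comp (innerSL ℂ y)

/-- The standard orthonormal basis vector `e_n` of `ℂ^d`. -/
def stdVec (d : ℕ) (n : Fin d) : E d := EuclideanSpace.single n 1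

/-- The standard rank-one projection `p_n = |e_n⟩⟨e_n|`. -/
def stdProj (d : ℕ) (n : Fin d) : Op d := rankOne (stdVec d n) (stdVec d n)

/-- The distance `D_W` on `W(H)`. -/
def DW {d : ℕ} (O O' : Set (Op d)) : ℝ :=
  sInf {r : ℝ | ∃ U : Op d, U ∈ unitary (Op d) ∧
    ((fun p => star U * p * U) '' O') = O ∧ r = ‖1 - U‖}

/-- The fiber `𝒢(U) = { ∑_n e^{iθ_n} U|e_{σ(n)}⟩⟨e_n| : σ ∈ Π(d), θ ∈ ℝ^d }`. -/
def GSet (d : ℕ) (U : Op d) : Set (Op d) :=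
  {K | ∃ (σ : Equiv.Perm (Fin d)) (θ : Fin d → ℝ),
    K = ∑ n, Complex.exp (θ n * Complex.I) • rankOne (U (stdVec d (σ n))) (stdVec d n)}

open scoped InnerProductSpace

section Aux

variable {d : ℕ}

lemma rankOne_apply (x y h : E d) : rankOne x y h = ⟪y, h⟫_ℂ • x := rfl

lemma mul_rankOne_mul_star (A : Op d) (x y : E d) :
    A * rankOne x y * star A = rankOne (A x) (A y) := by
  ext1 h
  simp [rankOne_apply, ContinuousLinearMap.star_eq_adjoint,
    ContinuousLinearMap.adjoint_inner_right]

lemma rankOne_smul_self {c : ℂ} (hc : ‖c‖ = 1) (x : E d) :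
    rankOne (c • x) (c • x) = rankOne x x := by
  ext1 h
  have hcc : (starRingEnd ℂ) c * c = 1 := by
    rw [← Complex.normSq_eq_conj_mul_self, Complex.normSq_eq_norm_sq, hc]
    simp
  simp only [rankOne_apply, inner_smul_left, smul_smul]
  rw [mul_right_comm, hcc, one_mul]

lemma inner_stdVec (m n : Fin d) : ⟪stdVec d m, stdVec d n⟫_ℂ = if m = n then 1 else 0 :=
  orthonormal_iff_ite.mp (EuclideanSpace.orthonormal_single (𝕜 := ℂ) (ι := Fin d)) m n

lemma clm_ext_stdVec {A B : Op d} (h : ∀ n, A (stdVec d n) = B (stdVec d n)) : A = B := by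
  have : (A : E d →ₗ[ℂ] E d) = B :=
    (EuclideanSpace.basisFun (Fin d) ℂ).toBasis.ext fun n => by
      simpa [stdVec] using h n
  exact ContinuousLinearMap.coe_injective this

lemma inner_map_unitary {A : Op d} (hA : A ∈ unitary (Op d)) (x y : E d) :
    ⟪A x, A y⟫_ℂ = ⟪x, y⟫_ℂ := by
  rw [← ContinuousLinearMap.adjoint_inner_right, ← ContinuousLinearMap.star_eq_adjoint,
    ← mul_apply_eq_comp, Unitary.star_mul_self_of_mem hA,
    one_apply_eq_self]

lemma mem_unitary_of_inner_stdVec {A : Op d}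
    (h : ∀ m n, ⟪A (stdVec d m), A (stdVec d n)⟫_ℂ = if m = n then 1 else 0) :
    A ∈ unitary (Op d) := by
  have h1 : star A * A = 1 := by
    refine clm_ext_stdVec fun n => ?_
    ext m
    have := h m n
    rw [← ContinuousLinearMap.adjoint_inner_right, ← inner_stdVec] at this
    simpa [stdVec, ContinuousLinearMap.star_eq_adjoint, EuclideanSpace.inner_single_left]
      using this
  have h2 : (A : E d →ₗ[ℂ] E d) * ((star A : Op d) : E d →ₗ[ℂ] E d) = 1 := by
    rw [mul_eq_one_comm]
    exact congrArg (fun B : Op d => (B : E d →ₗ[ℂ] E d)) h1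
  exact Unitary.mem_iff.mpr ⟨h1, ContinuousLinearMap.coe_injective h2⟩

lemma mem_GSet_iff {U K : Op d} : K ∈ GSet d U ↔
    ∃ (σ : Equiv.Perm (Fin d)) (c : Fin d → ℂ), (∀ n, ‖c n‖ = 1) ∧
      ∀ n, K (stdVec d n) = c n • U (stdVec d (σ n)) := by
  have key (σ : Equiv.Perm (Fin d)) (c : Fin d → ℂ) (n : Fin d) :
      (∑ m, c m • rankOne (U (stdVec d (σ m))) (stdVec d m)) (stdVec d n) =
        c n • U (stdVec d (σ n)) := by
    simp [rankOne_apply, inner_stdVec]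
  constructor
  · rintro ⟨σ, θ, rfl⟩
    exact ⟨σ, fun n => Complex.exp (θ n * Complex.I),
      fun n => Complex.norm_exp_ofReal_mul_I _, key σ _⟩
  · rintro ⟨σ, c, hc, h⟩
    have he (n : Fin d) : Complex.exp (Complex.arg (c n) * Complex.I) = c n := by
      simpa [hc n] using Complex.norm_mul_exp_arg_mul_I (c n)
    refine ⟨σ, fun n => Complex.arg (c n), clm_ext_stdVec fun n => ?_⟩
    simp only [he]
    rw [h, key]

lemma mem_unitary_of_mem_GSet {U K : Op d} (hU : U ∈ unitary (Op d)) (hK : K ∈ GSet d U) :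
    K ∈ unitary (Op d) := by
  obtain ⟨σ, c, hc, h⟩ := mem_GSet_iff.mp hK
  refine mem_unitary_of_inner_stdVec fun m n => ?_
  rw [h, h, inner_smul_left, inner_smul_right, inner_map_unitary hU, inner_stdVec]
  by_cases hmn : m = n
  · subst hmn
    have : (starRingEnd ℂ) (c m) * c m = 1 := by
      rw [← Complex.normSq_eq_conj_mul_self, Complex.normSq_eq_norm_sq, hc]
      simp
    simpa using this
  · simp [hmn]

lemma self_mem_GSet (U : Op d) : U ∈ GSet d U :=
  mem_GSet_iff.mpr ⟨1, 1, by simp, by simp⟩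

/-- Every element of the fiber over `U` induces the same orthonormal decomposition as `U`. -/
lemma range_conj_eq_of_mem_GSet {U K : Op d} (hK : K ∈ GSet d U) :
    (Set.range fun n => K * stdProj d n * star K) =
      Set.range fun n => U * stdProj d n * star U := by
  obtain ⟨σ, c, hc, h⟩ := mem_GSet_iff.mp hK
  rw [← σ.surjective.range_comp fun n => U * stdProj d n * star U]
  congr 1
  ext1 n
  simp only [Function.comp_apply, stdProj, mul_rankOne_mul_star, h, rankOne_smul_self (hc n)]

/-- Conversely, unitaries inducing the same orthonormal decomposition lie in the same fiber. -/
lemma mem_GSet_of_range_conj_eq {U K : Op d} (hK : K ∈ unitary (Op d)) (hU : U ∈ unitary (Op d))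
    (h : (Set.range fun n => K * stdProj d n * star K) =
      Set.range fun n => U * stdProj d n * star U) :
    K ∈ GSet d U := by
  have hex (n : Fin d) : ∃ m, rankOne (U (stdVec d m)) (U (stdVec d m)) =
      rankOne (K (stdVec d n)) (K (stdVec d n)) := by
    have : K * stdProj d n * star K ∈ Set.range fun n => U * stdProj d n * star U :=
      h ▸ Set.mem_range_self n
    simpa only [stdProj, mul_rankOne_mul_star, Set.mem_range] using this
  choose σ hσ using hex
  have hinj : Function.Injective σ := by
    intro m n hmn
    by_contra hne
    have h1 : rankOne (K (stdVec d m)) (K (stdVec d m)) (K (stdVec d m)) =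
        rankOne (K (stdVec d n)) (K (stdVec d n)) (K (stdVec d m)) := by
      rw [← hσ m, ← hσ n, hmn]
    rw [rankOne_apply, rankOne_apply, inner_map_unitary hK, inner_map_unitary hK, inner_stdVec,
      inner_stdVec, if_pos rfl, if_neg (Ne.symm hne), one_smul, zero_smul] at h1
    have h2 := inner_map_unitary hK (stdVec d m) (stdVec d m)
    rw [h1, inner_zero_left, inner_stdVec, if_pos rfl] at h2
    exact zero_ne_one h2
  have hnorm {A : Op d} (hA : A ∈ unitary (Op d)) (n : Fin d) : ‖A (stdVec d n)‖ = 1 := by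
    rw [norm_eq_sqrt_re_inner (𝕜 := ℂ), inner_map_unitary hA, inner_stdVec]
    simp
  have hK' (n : Fin d) : K (stdVec d n) =
      ⟪U (stdVec d (σ n)), K (stdVec d n)⟫_ℂ • U (stdVec d (σ n)) := by
    rw [← rankOne_apply, hσ, rankOne_apply, inner_map_unitary hK, inner_stdVec, if_pos rfl,
      one_smul]
  refine mem_GSet_iff.mpr ⟨Equiv.ofBijective σ (Finite.injective_iff_bijective.mp hinj),
    fun n => ⟪U (stdVec d (σ n)), K (stdVec d n)⟫_ℂ, fun n => ?_, hK'⟩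
  have := congrArg norm (hK' n)
  rwa [norm_smul, hnorm hK, hnorm hU, mul_one, eq_comm] at this

lemma image_conj_range_conj (W V : Op d) :
    (fun p => star W * p * W) '' (Set.range fun n => V * stdProj d n * star V) =
      Set.range fun n => (star W * V) * stdProj d n * star (star W * V) := by
  rw [← Set.range_comp]
  congr 1
  ext1 n
  simp only [Function.comp_apply, star_mul, star_star, mul_assoc]

end Aux

/-- `D_W({U p_n U*}_n, {V p_n V*}_n) = inf {‖K − G‖ : K ∈ 𝒢(U), G ∈ 𝒢(V)}`. -/
theorem DW_eq_inf_dist_fibers (d : ℕ) (hd : 1 ≤ d) (U V : Op d)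
    (hU : U ∈ unitary (Op d)) (hV : V ∈ unitary (Op d)) :
    DW (Set.range fun n => U * stdProj d n * star U)
        (Set.range fun n => V * stdProj d n * star V) =
      sInf {r : ℝ | ∃ K ∈ GSet d U, ∃ G ∈ GSet d V, r = ‖K - G‖} := by
  unfold DW
  congr 1
  ext r
  constructor
  · rintro ⟨W, hW, hO, rfl⟩
    rw [image_conj_range_conj] at hO
    have hWV : star W * V ∈ unitary (Op d) := mul_mem (Unitary.star_mem hW) hV
    refine ⟨star W * V, mem_GSet_of_range_conj_eq hWV hU hO, V, self_mem_GSet V, ?_⟩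
    rw [← CStarRing.norm_mem_unitary_mul (star W * V - V) hW, mul_sub, ← mul_assoc,
      Unitary.mul_star_self_of_mem hW, ← sub_mul, CStarRing.norm_mul_mem_unitary _ hV]
  · rintro ⟨K, hK, G, hG, rfl⟩
    have hKu := mem_unitary_of_mem_GSet hU hK
    have hGu := mem_unitary_of_mem_GSet hV hG
    refine ⟨G * star K, mul_mem hGu (Unitary.star_mem hKu), ?_, ?_⟩
    · rw [← range_conj_eq_of_mem_GSet hG, image_conj_range_conj,
        ← range_conj_eq_of_mem_GSet hK, star_mul, star_star, mul_assoc,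
        Unitary.star_mul_self_of_mem hGu, mul_one]
    · rw [← CStarRing.norm_mul_mem_unitary (1 - G * star K) hKu, sub_mul, one_mul, mul_assoc,
        Unitary.star_mul_self_of_mem hKu, mul_one]
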